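/- Let ξ > 0 and a < b be real numbers. Then the derivative of B^{[1]}_{a,b} at the right endpoint b equals ρ(b−a), where ρ(t) = (sinh(2 ξ t) − 2 ξ t)/(4 ξ sinh²(ξ t)). -/

import Mathlib

/-- `Φ_ξ(t) = (ξ t cosh(ξ t) − sinh(ξ t)) / (2 ξ³)`. -/
noncomputable def Phi (ξ t : ℝ) : ℝ :=
  (ξ * t * Real.cosh (ξ * t) - Real.sinh (ξ * t)) / (2 * ξ ^ 3)

/-- `ψ_ξ(t) = sinh(ξ t) / ξ`. -/
noncomputable def psi (ξ t : ℝ) : ℝ := Real.sinh (ξ * t) / ξ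

/-- `A^{[2]}_{a,b}(t) = sinh(ξ(t−b)) / sinh(ξ(a−b))`. -/
noncomputable def A2 (ξ a b t : ℝ) : ℝ :=
  Real.sinh (ξ * (t - b)) / Real.sinh (ξ * (a - b))

/-- `B^{[2]}_{a,b}(t) = sinh(ξ(t−a)) / sinh(ξ(b−a))`. -/
noncomputable def B2 (ξ a b t : ℝ) : ℝ :=
  Real.sinh (ξ * (t - a)) / Real.sinh (ξ * (b - a))

/-- `A^{[1]}_{a,b}(t) = Φ_ξ(t−b)/ψ_ξ(a−b) − A^{[2]}_{a,b}(t)·Φ_ξ(a−b)/ψ_ξ(a−b)`. -/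
noncomputable def A1 (ξ a b t : ℝ) : ℝ :=
  Phi ξ (t - b) / psi ξ (a - b) - A2 ξ a b t * (Phi ξ (a - b) / psi ξ (a - b))

/-- `B^{[1]}_{a,b}(t) = Φ_ξ(t−a)/ψ_ξ(b−a) − (Φ_ξ(b−a)/ψ_ξ(b−a))·B^{[2]}_{a,b}(t)`. -/
noncomputable def B1 (ξ a b t : ℝ) : ℝ :=
  Phi ξ (t - a) / psi ξ (b - a) - Phi ξ (b - a) / psi ξ (b - a) * B2 ξ a b t

/-- `ρ(t) = (sinh(2ξt) − 2ξt) / (4ξ sinh²(ξt))`. -/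
noncomputable def rho (ξ t : ℝ) : ℝ :=
  (Real.sinh (2 * ξ * t) - 2 * ξ * t) / (4 * ξ * Real.sinh (ξ * t) ^ 2)

/-- `σ(t) = (ξ t cosh(ξ t) − sinh(ξ t)) / (2ξ sinh²(ξt))`. -/
noncomputable def sigma (ξ t : ℝ) : ℝ :=
  (ξ * t * Real.cosh (ξ * t) - Real.sinh (ξ * t)) / (2 * ξ * Real.sinh (ξ * t) ^ 2)

theorem hasDerivAt_sinh_mul_sub (ξ a t : ℝ) :
    HasDerivAt (fun t => Real.sinh (ξ * (t - a))) (ξ * Real.cosh (ξ * (t - a))) t := by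
  have h := (((hasDerivAt_id t).sub_const a).const_mul ξ).sinh
  simpa [mul_comm] using h

theorem hasDerivAt_Phi {ξ : ℝ} (hξ : ξ ≠ 0) (a t : ℝ) :
    HasDerivAt (fun t => Phi ξ (t - a)) ((t - a) * Real.sinh (ξ * (t - a)) / (2 * ξ)) t := by
  have hlin : HasDerivAt (fun t => ξ * (t - a)) ξ t := by
    simpa using ((hasDerivAt_id t).sub_const a).const_mul ξ
  have h := ((hlin.mul hlin.cosh).sub hlin.sinh).div_const (2 * ξ ^ 3)
  refine h.congr_deriv ?_
  field_simp
  ring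

/-- The derivative of `B^{[1]}_{a,b}` at the right endpoint `b` equals `ρ(b−a)`. -/
theorem deriv_B1_right (ξ a b : ℝ) (hξ : 0 < ξ) (hab : a < b) :
    deriv (B1 ξ a b) b = rho ξ (b - a) := by
  have hpos : 0 < ξ * (b - a) := mul_pos hξ (sub_pos.2 hab)
  have hs : Real.sinh (ξ * (b - a)) ≠ 0 := (Real.sinh_pos_iff.2 hpos).ne'
  have h : HasDerivAt (B1 ξ a b) _ b :=
    ((hasDerivAt_Phi hξ.ne' a b).div_const (psi ξ (b - a))).sub
      (((hasDerivAt_sinh_mul_sub ξ a b).div_const (Real.sinh (ξ * (b - a)))).const_mul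
        (Phi ξ (b - a) / psi ξ (b - a)))
  rw [h.deriv]
  have h_two : Real.sinh (2 * ξ * (b - a)) =
      2 * Real.sinh (ξ * (b - a)) * Real.cosh (ξ * (b - a)) := by
    rw [mul_assoc, Real.sinh_two_mul]
  have h_sq := Real.cosh_sq (ξ * (b - a))
  simp only [rho, Phi, psi, h_two]
  generalize Real.sinh (ξ * (b - a)) = s at *
  generalize Real.cosh (ξ * (b - a)) = c at *
  have hξ0 := hξ.ne'
  field_simp
  linear_combination (-4 * ξ * (b - a)) * h_sq
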